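/- Let $v_1, v_2$ be nonzero complex numbers with $|v_1| \le |v_2|$. If $\left| \frac{v_1}{|v_1|} - \frac{v_2}{|v_2|} \right| \ge \varepsilon$ for some $\varepsilon \ge 0$, then $|v_1 + v_2| \le (1 - \varepsilon^2/4)|v_1| + |v_2|$. -/

import Mathlib

theorem stmt0 (v₁ v₂ : ℂ) (hv₁ : v₁ ≠ 0) (hv₂ : v₂ ≠ 0) (ε : ℝ) (hε : 0 ≤ ε)
    (hle : ‖v₁‖ ≤ ‖v₂‖)
    (hsep : ε ≤ ‖v₁ / (‖v₁‖ : ℂ) - v₂ / (‖v₂‖ : ℂ)‖) :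
    ‖v₁ + v₂‖ ≤ (1 - ε ^ 2 / 4) * ‖v₁‖ + ‖v₂‖ := by
  have ha : 0 < ‖v₁‖ := norm_pos_iff.mpr hv₁
  have hb : 0 < ‖v₂‖ := norm_pos_iff.mpr hv₂
  have e1 : v₁ = (‖v₁‖ : ℂ) * (v₁ / (‖v₁‖ : ℂ)) := by
    have : (‖v₁‖ : ℂ) ≠ 0 := by exact_mod_cast ha.ne'
    field_simp
  have e2 : v₂ = (‖v₂‖ : ℂ) * (v₂ / (‖v₂‖ : ℂ)) := by
    have : (‖v₂‖ : ℂ) ≠ 0 := by exact_mod_cast hb.ne'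
    field_simp
  have n1 : ‖v₁ / (‖v₁‖ : ℂ)‖ ^ 2 = 1 := by
    rw [norm_div, Complex.norm_real, norm_norm, div_self ha.ne', one_pow]
  have n2 : ‖v₂ / (‖v₂‖ : ℂ)‖ ^ 2 = 1 := by
    rw [norm_div, Complex.norm_real, norm_norm, div_self hb.ne', one_pow]
  have hsq : ε ^ 2 ≤ ‖v₁ / (‖v₁‖ : ℂ) - v₂ / (‖v₂‖ : ℂ)‖ ^ 2 := by gcongr
  have e3 : ‖v₁ + v₂‖ ^ 2 =
      ‖(‖v₁‖ : ℂ) * (v₁ / (‖v₁‖ : ℂ)) + (‖v₂‖ : ℂ) * (v₂ / (‖v₂‖ : ℂ))‖ ^ 2 := by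
    rw [← e1, ← e2]
  generalize v₁ / (‖v₁‖ : ℂ) = u at *
  generalize v₂ / (‖v₂‖ : ℂ) = w at *
  clear e1 e2 hsep
  generalize ‖v₁ + v₂‖ = s at *
  generalize ‖v₁‖ = a at *
  generalize ‖v₂‖ = b at *
  rw [Complex.sq_norm, Complex.normSq_apply] at n1 n2 hsq e3
  simp only [Complex.add_re, Complex.add_im, Complex.sub_re, Complex.sub_im,
    Complex.re_ofReal_mul, Complex.im_ofReal_mul] at hsq e3
  obtain ⟨c, hc⟩ : ∃ c, c = u.re * w.re + u.im * w.im := ⟨_, rfl⟩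
  have h3 : s ^ 2 = a ^ 2 + b ^ 2 + 2 * a * b * c := by
    rw [e3, hc]; linear_combination a ^ 2 * n1 + b ^ 2 * n2
  have h4 : ε ^ 2 ≤ 2 - 2 * c := by
    rw [hc]; nlinarith
  have h5 : -1 ≤ c := by
    rw [hc]; nlinarith [sq_nonneg (u.re + w.re), sq_nonneg (u.im + w.im)]
  obtain ⟨d, hd⟩ : ∃ d, d = ε ^ 2 / 4 := ⟨_, rfl⟩
  have hd0 : 0 ≤ d := by rw [hd]; positivity
  have hd1 : d ≤ 1 := by linarith
  have hcd : c ≤ 1 - 2 * d := by linarith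
  rw [← hd]
  have hr : 0 ≤ (1 - d) * a + b := by
    have := mul_nonneg (sub_nonneg.mpr hd1) ha.le
    linarith
  refine le_trans (le_abs_self s) (abs_le_of_sq_le_sq ?_ hr)
  have k1 : a * b * c ≤ a * b * (1 - 2 * d) :=
    mul_le_mul_of_nonneg_left hcd (by positivity)
  have k2 : 0 ≤ a * d * (b - a) := mul_nonneg (by positivity) (by linarith)
  nlinarith [sq_nonneg (a * d)]
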